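/- (Kronecker approximation) For c = (c₁, …, c_d) ∈ ℝᵈ, the subgroup cℤ + ℤᵈ is dense in ℝᵈ if and only if the real numbers 1, c₁, …, c_d are linearly independent over ℚ. -/

import Mathlib

open MeasureTheory UnitAddTorus

lemma mFourier_add_apply {d : Type*} [Fintype d] (k : d → ℤ) (x y : UnitAddTorus d) :
    mFourier k (x + y) = mFourier k x * mFourier k y := by
  simp only [mFourier, ContinuousMap.coe_mk, Pi.add_apply, ← Finset.prod_mul_distrib]
  refine Finset.prod_congr rfl fun i _ ↦ ?_
  simp [fourier_apply, AddCircle.toCircle_add]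

lemma mFourier_nsmul_apply {d : Type*} [Fintype d] (k : d → ℤ) (n : ℕ) (x : UnitAddTorus d) :
    mFourier k (n • x) = mFourier k x ^ n := by
  induction n with
  | zero => simp [mFourier]
  | succ n ih => rw [succ_nsmul, mFourier_add_apply, ih, pow_succ]

lemma norm_mFourier_apply {d : Type*} [Fintype d] (k : d → ℤ) (x : UnitAddTorus d) :
    ‖mFourier k x‖ = 1 := by
  simp only [mFourier, ContinuousMap.coe_mk, fourier_apply, norm_prod, Circle.norm_coe,
    Finset.prod_const_one]

lemma mFourier_coe_eq_one_iff {d : Type*} [Fintype d] (k : d → ℤ) (c : d → ℝ) :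
    mFourier k (fun i ↦ (c i : UnitAddCircle)) = 1 ↔ ∃ m : ℤ, ∑ i, (k i : ℝ) * c i = m := by
  have h : mFourier k (fun i ↦ (c i : UnitAddCircle)) =
      Complex.exp ((∑ i, (k i : ℝ) * c i : ℝ) * (2 * Real.pi * Complex.I)) := by
    simp only [mFourier, ContinuousMap.coe_mk, fourier_coe_apply, ← Complex.exp_sum]
    congr 1
    push_cast
    rw [Finset.sum_mul]
    exact Finset.sum_congr rfl fun i _ ↦ by ring
  rw [h, Complex.exp_eq_one_iff]
  refine exists_congr fun m ↦ ?_
  rw [mul_left_inj' Complex.two_pi_I_ne_zero]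
  exact_mod_cast Iff.rfl

section Equidistribution

variable {d : Type*} [Fintype d] {μ : Measure (UnitAddTorus d)} [μ.IsAddLeftInvariant]

lemma integral_mFourier_eq_zero {k : d → ℤ} {x : UnitAddTorus d} (h : mFourier k x ≠ 1) :
    ∫ y, mFourier k y ∂μ = 0 := by
  have hinv := integral_add_left_eq_self (μ := μ) (fun y ↦ mFourier k y) x
  simp only [mFourier_add_apply, integral_const_mul] at hinv
  by_contra hne
  exact h (mul_right_cancel₀ hne (by rw [hinv, one_mul]))

variable [IsProbabilityMeasure μ]

/-- Trigonometric polynomials have bounded discrepancy along the orbit of a generic point. -/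
lemma exists_discrepancy_bound {x : UnitAddTorus d} (hx : ∀ k ≠ 0, mFourier k x ≠ 1)
    {p : C(UnitAddTorus d, ℂ)} (hp : p ∈ Submodule.span ℂ (Set.range (mFourier (d := d)))) :
    ∃ C : ℝ, ∀ N : ℕ, ‖∑ n ∈ Finset.range N, p (n • x) - N * ∫ y, p y ∂μ‖ ≤ C := by
  have hint (f : C(UnitAddTorus d, ℂ)) : Integrable (fun y ↦ f y) μ :=
    f.continuous.integrable_of_hasCompactSupport (.of_compactSpace _)
  induction hp using Submodule.span_induction with
  | mem p hp =>
    obtain ⟨k, rfl⟩ := hp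
    rcases eq_or_ne k 0 with rfl | hk
    · exact ⟨0, fun N ↦ by simp [mFourier_zero]⟩
    · refine ⟨2 / ‖mFourier k x - 1‖, fun N ↦ ?_⟩
      simp only [integral_mFourier_eq_zero (hx k hk), mFourier_nsmul_apply, mul_zero, sub_zero]
      rw [geom_sum_eq (hx k hk), norm_div]
      gcongr
      refine (norm_sub_le _ _).trans ?_
      rw [norm_pow, norm_mFourier_apply, one_pow, norm_one]
      norm_num
  | zero => exact ⟨0, fun N ↦ by simp⟩
  | add p q _ _ hp hq =>
    obtain ⟨C, hC⟩ := hp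
    obtain ⟨D, hD⟩ := hq
    refine ⟨C + D, fun N ↦ ?_⟩
    simp only [ContinuousMap.add_apply, integral_add (hint p) (hint q), Finset.sum_add_distrib]
    rw [mul_add, add_sub_add_comm]
    exact norm_add_le_of_le (hC N) (hD N)
  | smul a p _ hp =>
    obtain ⟨C, hC⟩ := hp
    refine ⟨‖a‖ * C, fun N ↦ ?_⟩
    simp only [ContinuousMap.smul_apply, smul_eq_mul, integral_const_mul, ← Finset.mul_sum]
    rw [mul_left_comm, ← mul_sub, norm_mul]
    gcongr
    exact hC N

lemma integral_eq_zero_of_forall_nsmul_eq_zero {x : UnitAddTorus d}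
    (hx : ∀ k ≠ 0, mFourier k x ≠ 1) {f : C(UnitAddTorus d, ℂ)} (hf : ∀ n : ℕ, f (n • x) = 0) :
    ∫ y, f y ∂μ = 0 := by
  have hint (f : C(UnitAddTorus d, ℂ)) : Integrable (fun y ↦ f y) μ :=
    f.continuous.integrable_of_hasCompactSupport (.of_compactSpace _)
  rw [← norm_le_zero_iff]
  refine le_of_forall_pos_le_add fun ε hε ↦ ?_
  have hmem : f ∈ (Submodule.span ℂ (Set.range (mFourier (d := d)))).topologicalClosure := by
    rw [span_mFourier_closure_eq_top]; trivial
  obtain ⟨p, hp, hfp⟩ := Metric.mem_closure_iff.mp hmem (ε / 2) (half_pos hε)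
  rw [dist_eq_norm] at hfp
  have hpt (y : UnitAddTorus d) : ‖f y - p y‖ ≤ ε / 2 :=
    ((f - p).norm_coe_le_norm y).trans hfp.le
  obtain ⟨C, hC⟩ := exists_discrepancy_bound (μ := μ) hx hp
  have hfpint : ‖∫ y, f y ∂μ - ∫ y, p y ∂μ‖ ≤ ε / 2 := by
    rw [← integral_sub (hint f) (hint p)]
    simpa using norm_integral_le_of_norm_le_const (μ := μ) (.of_forall hpt)
  have hpint : ‖∫ y, p y ∂μ‖ ≤ ε / 2 := by
    by_contra! hlt
    obtain ⟨N, hN⟩ := exists_nat_gt (C / (‖∫ y, p y ∂μ‖ - ε / 2))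
    rw [div_lt_iff₀ (sub_pos.mpr hlt)] at hN
    have hsum : ‖∑ n ∈ Finset.range N, p (n • x)‖ ≤ N * (ε / 2) := by
      have hle := norm_sum_le_of_le (Finset.range N) (f := fun n ↦ p (n • x))
        (n := fun _ ↦ ε / 2) fun n _ ↦ by simpa [hf n] using hpt (n • x)
      simpa using hle
    have htri := norm_sub_norm_le ((N : ℂ) * ∫ y, p y ∂μ) (∑ n ∈ Finset.range N, p (n • x))
    rw [norm_sub_rev, norm_mul, Complex.norm_natCast] at htri
    linarith [hC N]
  linarith [norm_sub_norm_le (∫ y, f y ∂μ) (∫ y, p y ∂μ)]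

end Equidistribution

lemma dense_range_nsmul_of_mFourier_ne_one {d : Type*} [Fintype d] {x : UnitAddTorus d}
    (hx : ∀ k ≠ 0, mFourier k x ≠ 1) : Dense (Set.range fun n : ℕ ↦ n • x) := by
  have : IsProbabilityMeasure (volume : Measure UnitAddCircle) :=
    ⟨by simp⟩
  intro y
  by_contra hy
  obtain ⟨f, hf0, hf1, hf⟩ := exists_continuous_zero_one_of_isClosed isClosed_closure
    isClosed_singleton (Set.disjoint_singleton_right.mpr hy)
  have hpos : 0 < ∫ z, f z ∂(volume : Measure (UnitAddTorus d)) :=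
    f.continuous.integral_pos_of_hasCompactSupport_nonneg_nonzero (.of_compactSpace _)
      (fun z ↦ (hf z).1) (x := y) (by simp [hf1 rfl])
  have hzero := integral_eq_zero_of_forall_nsmul_eq_zero
    (μ := (volume : Measure (UnitAddTorus d))) hx
    (f := ⟨fun z ↦ (f z : ℂ), by fun_prop⟩)
    (fun n ↦ by simpa using hf0 (subset_closure ⟨n, rfl⟩))
  simp only [ContinuousMap.coe_mk, integral_complex_ofReal, Complex.ofReal_eq_zero] at hzero
  exact hpos.ne' hzero

theorem linearIndependent_cons_one_iff {d : ℕ} {c : Fin d → ℝ} :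
    LinearIndependent ℚ (Fin.cons (1 : ℝ) c : Fin (d + 1) → ℝ) ↔
      ∀ k : Fin d → ℤ, (∃ m : ℤ, ∑ i, (k i : ℝ) * c i = m) → k = 0 := by
  rw [← LinearIndependent.iff_fractionRing ℤ ℚ, Fintype.linearIndependent_iff]
  simp only [Fin.sum_univ_succ, Fin.cons_zero, Fin.cons_succ, zsmul_eq_mul, mul_one]
  constructor
  · rintro h k ⟨m, hm⟩
    ext i
    simpa using h (Fin.cons (-m) k) (by simp [hm]) i.succ
  · intro h g hg
    have hk := h (fun i ↦ g i.succ) ⟨-g 0, by push_cast; linarith⟩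
    have hk' (i : Fin d) : g i.succ = 0 := congrFun hk i
    refine Fin.cases ?_ hk'
    simpa [hk'] using hg

/-- A linear form with integer coefficients that is integral on a dense set vanishes. -/
lemma eq_zero_of_dense_of_forall_mem_range_intCast {d : Type*} [Fintype d] {s : Set (d → ℝ)}
    (hs : Dense s) {k : d → ℤ}
    (h : ∀ x ∈ s, ∑ i, (k i : ℝ) * x i ∈ Set.range ((↑) : ℤ → ℝ)) : k = 0 := by
  classical
  have hcl : IsClosed {x : d → ℝ | ∑ i, (k i : ℝ) * x i ∈ Set.range ((↑) : ℤ → ℝ)} :=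
    Int.isClosedEmbedding_coe_real.isClosed_range.preimage (by fun_prop)
  have hall (x : d → ℝ) : ∑ i, (k i : ℝ) * x i ∈ Set.range ((↑) : ℤ → ℝ) :=
    hcl.closure_subset_iff.mpr h (hs x)
  ext i
  by_contra hi
  have hi' : (k i : ℝ) ≠ 0 := by exact_mod_cast hi
  obtain ⟨m, hm⟩ := hall (Pi.single i (1 / (2 * k i)))
  have hval : ∑ j, (k j : ℝ) * (Pi.single i (1 / (2 * (k i : ℝ))) : d → ℝ) j = 1 / 2 := by
    rw [Finset.sum_eq_single i (fun j _ hj ↦ by simp [hj]) (by simp), Pi.single_eq_same]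
    field_simp
  rw [hval] at hm
  have : (2 * m : ℝ) = 1 := by linarith
  have : 2 * m = 1 := by exact_mod_cast this
  omega

theorem stmt_13 (d : ℕ) (c : Fin d → ℝ) :
    Dense {x : Fin d → ℝ | ∃ (n : ℤ) (m : Fin d → ℤ),
        x = fun i => (n : ℝ) * c i + (m i : ℝ)} ↔
      LinearIndependent ℚ (Fin.cons (1 : ℝ) c : Fin (d + 1) → ℝ) := by
  rw [linearIndependent_cons_one_iff]
  constructor
  · rintro hd k ⟨m, hm⟩
    refine eq_zero_of_dense_of_forall_mem_range_intCast hd ?_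
    rintro _ ⟨n, l, rfl⟩
    refine ⟨n * m + ∑ i, k i * l i, ?_⟩
    push_cast
    rw [← hm, Finset.mul_sum, ← Finset.sum_add_distrib]
    exact Finset.sum_congr rfl fun i _ ↦ by ring
  · intro h
    have hdense := dense_range_nsmul_of_mFourier_ne_one
      (x := fun i ↦ (c i : UnitAddCircle)) fun k hk hk1 ↦
        hk (h k ((mFourier_coe_eq_one_iff k c).mp hk1))
    have hquot : IsOpenQuotientMap
        (Pi.map fun (_ : Fin d) (t : ℝ) ↦ (t : UnitAddCircle)) :=
      .piMap fun _ ↦ QuotientAddGroup.isOpenQuotientMap_mk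
    refine (hquot.dense_preimage_iff.mpr hdense).mono ?_
    rintro y ⟨n, hn⟩
    have hm (i : Fin d) : ∃ m : ℤ, y i = n * c i + m := by
      have hi : n • (c i : UnitAddCircle) = (y i : UnitAddCircle) := congrFun hn i
      rw [← AddCircle.coe_nsmul, eq_comm, ← sub_eq_zero, ← AddCircle.coe_sub,
        AddCircle.coe_eq_zero_iff] at hi
      obtain ⟨m, hm⟩ := hi
      exact ⟨m, by simp at hm; linarith⟩
    choose m hm using hm
    exact ⟨n, m, funext fun i ↦ by simpa using hm i⟩
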